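/- Let n ≥ 1 be an integer and ω ∈ 𝒲 with associated function τ. There is a number ρ₀ ∈ (0,1) such that for each α ∈ 𝔻 with |α| ≥ ρ₀ there is a bounded analytic function F_{α,n} on 𝔻 such that, with implicit constants uniform in α: |F_{α,n}(z)|² ω(z) ≍ 1 whenever |z − α| < τ(α); |F_{α,n}(z)| ω(z)^{1/2} ≲ min(1, min(τ(α), τ(z))/|z − α|)^{3n} for all z ∈ 𝔻; and ‖F_{α,n}‖_{A²_ω} ≍ τ(α) for ρ₀ ≤ |α| < 1. -/

import Mathlib

open MeasureTheory Filter Set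
open scoped ENNReal ComplexOrder

noncomputable section

/-- The open unit disc in `ℂ`. -/
def unitDisc : Set ℂ := Metric.ball (0 : ℂ) 1

/-- Normalized area Lebesgue measure `dA = dx dy / π` on `ℂ`. -/
def dA : Measure ℂ := (ENNReal.ofReal Real.pi)⁻¹ • (volume : Measure ℂ)

/-- The weighted measure `ω dA` on the unit disc. -/
def muW (ω : ℂ → ℝ) : Measure ℂ :=
  (dA.restrict unitDisc).withDensity fun z => ENNReal.ofReal (ω z)

/-- The radial extension to `𝔻` of a function of `r ∈ [0,1)`. -/
def radialize (τ : ℝ → ℝ) : ℂ → ℝ := fun z => τ ‖z‖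

/-- The class `𝓛`, with constants `c₁, c₂`. -/
structure IsClassL (τC : ℂ → ℝ) (c₁ c₂ : ℝ) : Prop where
  c₁_pos : 0 < c₁
  c₂_pos : 0 < c₂
  pos : ∀ z ∈ unitDisc, 0 < τC z
  upper : ∀ z ∈ unitDisc, τC z ≤ c₁ * (1 - ‖z‖)
  lip : ∀ z ∈ unitDisc, ∀ ζ ∈ unitDisc, |τC z - τC ζ| ≤ c₂ * ‖z - ζ‖

/-- `m_τ = min(1, c₁⁻¹, c₂⁻¹)/4`. -/
def mTau (c₁ c₂ : ℝ) : ℝ := min 1 (min c₁⁻¹ c₂⁻¹) / 4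

/-- The Laplacian `Δφ = φ_xx + φ_yy` of a function `φ : ℂ → ℝ`. -/
def laplacian (φ : ℂ → ℝ) (z : ℂ) : ℝ :=
  fderiv ℝ (fun w => fderiv ℝ φ w 1) z 1 +
    fderiv ℝ (fun w => fderiv ℝ φ w Complex.I) z Complex.I

/-- The Wirtinger derivative `∂̄g = (g_x + i g_y)/2` of `g : ℂ → ℂ`. -/
def dbar (g : ℂ → ℂ) (z : ℂ) : ℂ :=
  (fderiv ℝ g z 1 + Complex.I * fderiv ℝ g z Complex.I) / 2

/-- The class `𝒲` of weights `ω = e^{-2φ}` with associated radial profile `τ`. -/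
structure IsClassW (ω φ : ℂ → ℝ) (τ : ℝ → ℝ) : Prop where
  pos : ∀ z ∈ unitDisc, 0 < ω z
  omega_eq : ∀ z ∈ unitDisc, ω z = Real.exp (-(2 * φ z))
  integrable : ∫⁻ z in unitDisc, ENNReal.ofReal (ω z) ∂dA < ⊤
  radial : ∀ z ∈ unitDisc, ∀ ζ ∈ unitDisc, ‖z‖ = ‖ζ‖ → φ z = φ ζ
  smooth : ContDiffOn ℝ 2 φ unitDisc
  lap_pos : ∀ z ∈ unitDisc, 0 < laplacian φ z
  tau_pos : ∀ r ∈ Set.Ico (0 : ℝ) 1, 0 < τ r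
  tau_anti : AntitoneOn τ (Set.Ico 0 1)
  tau_lim : Tendsto τ (nhdsWithin 1 (Set.Iio 1)) (nhds 0)
  tau_diff : ∀ r ∈ Set.Ico (0 : ℝ) 1, DifferentiableAt ℝ τ r
  tau_deriv_lim : Tendsto (deriv τ) (nhdsWithin 1 (Set.Iio 1)) (nhds 0)
  comp : ∃ C : ℝ, 1 ≤ C ∧ ∀ z ∈ unitDisc,
    τ ‖z‖ / C ≤ (laplacian φ z) ^ (-(1 / 2 : ℝ)) ∧
      (laplacian φ z) ^ (-(1 / 2 : ℝ)) ≤ C * τ ‖z‖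
  extra : (∃ C > (0 : ℝ), ∃ r₀ ∈ Set.Ico (0 : ℝ) 1,
      MonotoneOn (fun r => τ r * (1 - r) ^ C) (Set.Ico r₀ 1)) ∨
    Tendsto (fun r => deriv τ r * Real.log (1 / τ r)) (nhdsWithin 1 (Set.Iio 1)) (nhds 0)

/-- A `(δ,τ)`-lattice of the unit disc. -/
structure IsLattice (τC : ℂ → ℝ) (δ : ℝ) (z : ℕ → ℂ) : Prop where
  mem : ∀ j, z j ∈ unitDisc
  sep : ∀ j k, j ≠ k → z j ∉ Metric.ball (z k) (δ * τC (z k))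
  covers : ∀ w ∈ unitDisc, ∃ j, w ∈ Metric.ball (z j) (δ * τC (z j))
  mult : ∃ N : ℕ, ∀ w ∈ unitDisc,
    ({j : ℕ | w ∈ Metric.ball (z j) (3 * (δ * τC (z j)))}).ncard ≤ N

/-- The distance `d_τ(z,ζ) = |z-ζ| / min(τ(z),τ(ζ))`. -/
def dTau (τC : ℂ → ℝ) (z ζ : ℂ) : ℝ := ‖z - ζ‖ / min (τC z) (τC ζ)

/-- `(1/|D(δτ(z))|) ∫_{D(δτ(z))} |u|² dA`, valued in `ℝ≥0∞`. -/
def localMeanE (τC : ℂ → ℝ) (δ : ℝ) (u : ℂ → ℂ) (z : ℂ) : ℝ≥0∞ :=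
  (ENNReal.ofReal ((δ * τC z) ^ 2))⁻¹ *
    ∫⁻ w in Metric.ball z (δ * τC z), ENNReal.ofReal (‖u w‖ ^ 2) ∂dA

/-- `F_δ(z)² = inf over h analytic in D(δτ(z)) of the mean square of g - h`. -/
def FdeltaSqE (τC : ℂ → ℝ) (δ : ℝ) (g : ℂ → ℂ) (z : ℂ) : ℝ≥0∞ :=
  ⨅ (h : ℂ → ℂ) (_ : DifferentiableOn ℂ h (Metric.ball z (δ * τC z))),
    localMeanE τC δ (fun w => g w - h w) z

/-- The submodule of `L²_ω` of elements with a representative analytic on `𝔻`. -/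
def bergmanSubmodule (ω : ℂ → ℝ) : Submodule ℂ (Lp ℂ 2 (muW ω)) where
  carrier := {f | ∃ F : ℂ → ℂ, DifferentiableOn ℂ F unitDisc ∧ (f : ℂ → ℂ) =ᵐ[muW ω] F}
  zero_mem' := ⟨0, differentiableOn_const 0, Lp.coeFn_zero ℂ 2 (muW ω)⟩
  add_mem' := by
    rintro a b ⟨F, hF, ha⟩ ⟨G, hG, hb⟩
    refine ⟨F + G, hF.add hG, ?_⟩
    filter_upwards [Lp.coeFn_add a b, ha, hb] with w h1 h2 h3
    rw [h1]; simp only [Pi.add_apply, h2, h3]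
  smul_mem' := by
    rintro c a ⟨F, hF, ha⟩
    refine ⟨c • F, hF.const_smul c, ?_⟩
    filter_upwards [Lp.coeFn_smul c a, ha] with w h1 h2
    rw [h1]; simp only [Pi.smul_apply, h2]

/-- The Bergman space `A²_ω`, a closed subspace of `L²_ω`. -/
def bergmanH (ω : ℂ → ℝ) : Submodule ℂ (Lp ℂ 2 (muW ω)) :=
  (bergmanSubmodule ω).topologicalClosure

instance (ω : ℂ → ℝ) : CompleteSpace (bergmanH ω) :=
  IsClosed.completeSpace_coe (hs := Submodule.isClosed_topologicalClosure _)

/-- The orthogonal (Bergman) projection of `L²_ω` onto `A²_ω`, valued in `A²_ω`. -/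
def bergmanProjA (ω : ℂ → ℝ) : Lp ℂ 2 (muW ω) →L[ℂ] bergmanH ω :=
  Submodule.orthogonalProjectionOnto (bergmanH ω)

/-- The Bergman projection `P`, viewed as an operator of `L²_ω`. -/
def bergmanProj (ω : ℂ → ℝ) : Lp ℂ 2 (muW ω) →L[ℂ] Lp ℂ 2 (muW ω) :=
  (bergmanH ω).subtypeL.comp (bergmanProjA ω)

/-- `T` is a bounded extension of the Hankel operator `H_g : f ↦ g f - P(g f)`,
defined on the bounded analytic functions `f ∈ H^∞`. -/
def IsHankelExtension (ω : ℂ → ℝ) (g : ℂ → ℂ)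
    (T : bergmanH ω →L[ℂ] Lp ℂ 2 (muW ω)) : Prop :=
  ∀ (f : bergmanH ω) (F : ℂ → ℂ) (M : ℝ),
    DifferentiableOn ℂ F unitDisc →
    (∀ z ∈ unitDisc, ‖F z‖ ≤ M) →
    ((f : Lp ℂ 2 (muW ω)) : ℂ → ℂ) =ᵐ[muW ω] F →
    ∀ gF : Lp ℂ 2 (muW ω), ((gF : ℂ → ℂ) =ᵐ[muW ω] fun z => g z * F z) →
    T f = gF - bergmanProj ω gF

/-- The `ν`-th singular number `s_ν(T) = inf{‖T - K‖ : rank K ≤ ν}`, `ν = 0, 1, 2, …`. -/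
def singularNumber {E F : Type*} [NormedAddCommGroup E] [NormedSpace ℂ E]
    [NormedAddCommGroup F] [NormedSpace ℂ F] (T : E →L[ℂ] F) (ν : ℕ) : ℝ :=
  sInf {c : ℝ | ∃ K : E →L[ℂ] F,
    Module.rank ℂ (LinearMap.range (K : E →ₗ[ℂ] F)) ≤ (ν : Cardinal) ∧ c = ‖T - K‖}

/-- `‖T‖_{S^p}^p = ∑_ν s_ν(T)^p`. -/
def schattenSum (p : ℝ) {E F : Type*} [NormedAddCommGroup E] [NormedSpace ℂ E]
    [NormedAddCommGroup F] [NormedSpace ℂ F] (T : E →L[ℂ] F) : ℝ :=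
  ∑' ν : ℕ, singularNumber T ν ^ p

/-- Membership in the Schatten class `S^p`: `∑_ν s_ν(T)^p < ∞`. -/
def MemSchatten (p : ℝ) {E F : Type*} [NormedAddCommGroup E] [NormedSpace ℂ E]
    [NormedAddCommGroup F] [NormedSpace ℂ F] (T : E →L[ℂ] F) : Prop :=
  Summable fun ν : ℕ => singularNumber T ν ^ p

/-- A bounded operator has finite rank. -/
def FiniteRank {E F : Type*} [NormedAddCommGroup E] [NormedSpace ℂ E]
    [NormedAddCommGroup F] [NormedSpace ℂ F] (T : E →L[ℂ] F) : Prop :=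
  Module.rank ℂ (LinearMap.range (T : E →ₗ[ℂ] F)) < Cardinal.aleph0

/-- The decay estimate `|F(z)| ω(z)^{1/2} ≲ min(1, min(τ(α),τ(z))/|z-α|)^{3n}` on `𝔻`. -/
def TestDecay (τC ω : ℂ → ℝ) (C₀ : ℝ) (n : ℕ) (α : ℂ) (F : ℂ → ℂ) : Prop :=
  (∀ z ∈ unitDisc, ‖F z‖ * Real.sqrt (ω z) ≤ C₀) ∧
    ∀ z ∈ unitDisc, z ≠ α → ‖F z‖ * Real.sqrt (ω z) ≤
      C₀ * (min (τC α) (τC z) / ‖z - α‖) ^ (3 * n)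

/-- Multiplication of an `L²_ω` element by the indicator of a measurable set `D`. -/
def indLp (ω : ℂ → ℝ) (D : Set ℂ) (hD : MeasurableSet D) (f : Lp ℂ 2 (muW ω)) :
    Lp ℂ 2 (muW ω) :=
  MemLp.toLp (D.indicator f) ((Lp.memLp f).indicator hD)

/-- The subspace of `L²_ω` of elements vanishing a.e. off `D` with a representative
analytic on `D`;  its closure realizes `A²_ω(D)` inside `L²_ω`. -/
def localBergmanSub (ω : ℂ → ℝ) (D : Set ℂ) : Submodule ℂ (Lp ℂ 2 (muW ω)) where
  carrier := {f | ((f : ℂ → ℂ) =ᵐ[(muW ω).restrict Dᶜ] 0) ∧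
    ∃ h : ℂ → ℂ, DifferentiableOn ℂ h D ∧ (f : ℂ → ℂ) =ᵐ[(muW ω).restrict D] h}
  zero_mem' := by
    refine ⟨ae_restrict_of_ae (Lp.coeFn_zero ℂ 2 (muW ω)), 0, differentiableOn_const 0,
      ae_restrict_of_ae (Lp.coeFn_zero ℂ 2 (muW ω))⟩
  add_mem' := by
    rintro a b ⟨ha0, F, hF, ha⟩ ⟨hb0, G, hG, hb⟩
    refine ⟨?_, F + G, hF.add hG, ?_⟩
    · filter_upwards [ae_restrict_of_ae (Lp.coeFn_add a b), ha0, hb0] with w h1 h2 h3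
      rw [h1]; simp only [Pi.add_apply, h2, h3, Pi.zero_apply, add_zero]
    · filter_upwards [ae_restrict_of_ae (Lp.coeFn_add a b), ha, hb] with w h1 h2 h3
      rw [h1]; simp only [Pi.add_apply, h2, h3]
  smul_mem' := by
    rintro c a ⟨ha0, F, hF, ha⟩
    refine ⟨?_, c • F, hF.const_smul c, ?_⟩
    · filter_upwards [ae_restrict_of_ae (Lp.coeFn_smul c a), ha0] with w h1 h2
      rw [h1]; simp only [Pi.smul_apply, h2, Pi.zero_apply, smul_zero]
    · filter_upwards [ae_restrict_of_ae (Lp.coeFn_smul c a), ha] with w h1 h2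
      rw [h1]; simp only [Pi.smul_apply, h2]

instance (ω : ℂ → ℝ) (D : Set ℂ) :
    CompleteSpace ((localBergmanSub ω D).topologicalClosure) :=
  IsClosed.completeSpace_coe (hs := Submodule.isClosed_topologicalClosure _)

/-- The local projection `P_{α,δ}` (for `D = D(δτ(α))`), extended by zero off `D`,
viewed as an operator of `L²_ω`. -/
def localProj (ω : ℂ → ℝ) (D : Set ℂ) : Lp ℂ 2 (muW ω) →L[ℂ] Lp ℂ 2 (muW ω) :=
  ((localBergmanSub ω D).topologicalClosure).subtypeL.comp
    (Submodule.orthogonalProjectionOnto ((localBergmanSub ω D).topologicalClosure))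

/-- Radial calculus: the profile of `φ` and its Laplacian. -/
lemma radial_core (φ : ℂ → ℝ)
    (hrad : ∀ z ∈ unitDisc, ∀ ζ ∈ unitDisc, ‖z‖ = ‖ζ‖ → φ z = φ ζ)
    (hs : ContDiffOn ℝ 2 φ unitDisc) :
    ∃ f1 : ℝ → ℝ, (∀ r ∈ Set.Ioo (-1 : ℝ) 1, HasDerivAt (fun s : ℝ => φ (s : ℂ)) (f1 r) r) ∧
      (∀ r ∈ Set.Ioo (-1 : ℝ) 1, ContinuousAt f1 r) ∧
      ∀ r ∈ Set.Ioo (0 : ℝ) 1,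
        HasDerivAt (fun s : ℝ => s * f1 s) (r * laplacian φ (r : ℂ)) r := by
  have hopen : IsOpen unitDisc := Metric.isOpen_ball
  have hmem : ∀ z : ℂ, z ∈ unitDisc ↔ ‖z‖ < 1 := fun z => by simp [unitDisc]
  have hmemr : ∀ r : ℝ, r ∈ Set.Ioo (-1 : ℝ) 1 → (r : ℂ) ∈ unitDisc := by
    intro r hr
    rw [hmem, Complex.norm_real, Real.norm_eq_abs, abs_lt]
    exact hr
  have hd : ∀ z ∈ unitDisc, HasFDerivAt φ (fderiv ℝ φ z) z := fun z hz =>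
    ((hs.contDiffAt (hopen.mem_nhds hz)).differentiableAt (by norm_num)).hasFDerivAt
  have hd2 : ∀ z ∈ unitDisc, DifferentiableAt ℝ (fderiv ℝ φ) z := fun z hz =>
    ((hs.contDiffAt (hopen.mem_nhds hz)).fderiv_right (m := 1) (by norm_num)).differentiableAt
      (by norm_num)
  have hdv : ∀ z ∈ unitDisc, ∀ v : ℂ, HasFDerivAt (fun w => fderiv ℝ φ w v)
      (fderiv ℝ (fun w => fderiv ℝ φ w v) z) z := fun z hz v =>
    ((hd2 z hz).clm_apply (differentiableAt_const v)).hasFDerivAt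
  have hofr : ∀ r : ℝ, HasDerivAt (fun s : ℝ => (s : ℂ)) 1 r := fun r =>
    Complex.ofRealCLM.hasDerivAt
  have hf : ∀ r ∈ Set.Ioo (-1 : ℝ) 1,
      HasDerivAt (fun s : ℝ => φ (s : ℂ)) (fderiv ℝ φ (r : ℂ) 1) r := by
    intro r hr
    exact (hd r (hmemr r hr)).comp_hasDerivAt r (hofr r)
  have hf1 : ∀ r ∈ Set.Ioo (-1 : ℝ) 1,
      HasDerivAt (fun s : ℝ => fderiv ℝ φ (s : ℂ) 1)
        (fderiv ℝ (fun w => fderiv ℝ φ w 1) (r : ℂ) 1) r := by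
    intro r hr
    exact (hdv r (hmemr r hr) 1).comp_hasDerivAt r (hofr r)
  refine ⟨fun r => fderiv ℝ φ (r : ℂ) 1, hf, fun r hr => (hf1 r hr).continuousAt, ?_⟩
  intro r hr
  have hr' : r ∈ Set.Ioo (-1 : ℝ) 1 := ⟨by linarith [hr.1], hr.2⟩
  have hr0 : 0 < r := hr.1
  -- the vertical direction
  have hline : ∀ s : ℝ, HasDerivAt (fun s : ℝ => (r : ℂ) + s * Complex.I) Complex.I s := by
    intro s
    simpa using ((hofr s).mul_const Complex.I).const_add (r : ℂ)
  have hnormv : ∀ s : ℝ, ‖(r : ℂ) + s * Complex.I‖ = Real.sqrt (r ^ 2 + s ^ 2) := by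
    intro s
    exact Complex.norm_add_mul_I r s
  have hk1 : HasDerivAt (fun s : ℝ => fderiv ℝ φ ((r : ℂ) + s * Complex.I) Complex.I)
      (fderiv ℝ (fun w => fderiv ℝ φ w Complex.I) (r : ℂ) Complex.I) 0 := by
    have h0 : (r : ℂ) + ((0 : ℝ) : ℂ) * Complex.I = r := by simp
    have := hdv r (hmemr r hr') Complex.I
    rw [← h0] at this
    have h2 := this.comp_hasDerivAt (0 : ℝ) (hline 0)
    rw [h0] at h2
    exact h2
  have hsq : ∀ s : ℝ, HasDerivAt (fun s : ℝ => Real.sqrt (r ^ 2 + s ^ 2))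
      (s / Real.sqrt (r ^ 2 + s ^ 2)) s := by
    intro s
    have hp : r ^ 2 + s ^ 2 ≠ 0 := by positivity
    have h1 : HasDerivAt (fun s : ℝ => r ^ 2 + s ^ 2) (2 * s) s := by
      simpa using (hasDerivAt_pow 2 s).const_add (r ^ 2)
    have := h1.sqrt hp
    convert this using 1
    field_simp
  have hsmall : ∀ᶠ s : ℝ in nhds 0, Real.sqrt (r ^ 2 + s ^ 2) < 1 := by
    have hc : ContinuousAt (fun s : ℝ => Real.sqrt (r ^ 2 + s ^ 2)) 0 := (hsq 0).continuousAt
    apply hc.eventually_lt continuousAt_const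
    simp [Real.sqrt_sq hr0.le, hr.2]
  have hsqmem : ∀ s : ℝ, Real.sqrt (r ^ 2 + s ^ 2) < 1 →
      Real.sqrt (r ^ 2 + s ^ 2) ∈ Set.Ioo (-1 : ℝ) 1 := fun s h =>
    ⟨by linarith [Real.sqrt_nonneg (r ^ 2 + s ^ 2)], h⟩
  have hkeq : (fun s : ℝ => fderiv ℝ φ ((r : ℂ) + s * Complex.I) Complex.I) =ᶠ[nhds 0]
      fun s : ℝ => fderiv ℝ φ ((Real.sqrt (r ^ 2 + s ^ 2) : ℝ) : ℂ) 1 *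
        (s / Real.sqrt (r ^ 2 + s ^ 2)) := by
    filter_upwards [hsmall.eventually_nhds] with s hs1
    have hs0 := hs1.self_of_nhds
    have hzm : (r : ℂ) + s * Complex.I ∈ unitDisc := by rw [hmem, hnormv]; exact hs0
    have e1 : HasDerivAt (fun s : ℝ => φ ((r : ℂ) + s * Complex.I))
        (fderiv ℝ φ ((r : ℂ) + s * Complex.I) Complex.I) s :=
      (hd _ hzm).comp_hasDerivAt s (hline s)
    have e2 : HasDerivAt (fun s : ℝ => φ ((Real.sqrt (r ^ 2 + s ^ 2) : ℝ) : ℂ))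
        (fderiv ℝ φ ((Real.sqrt (r ^ 2 + s ^ 2) : ℝ) : ℂ) 1 *
        (s / Real.sqrt (r ^ 2 + s ^ 2))) s :=
      HasDerivAt.comp (h₂ := fun u : ℝ => φ (u : ℂ)) s (hf _ (hsqmem s hs0)) (hsq s)
    refine e1.unique (e2.congr_of_eventuallyEq ?_)
    filter_upwards [hs1] with u hu
    apply hrad
    · rw [hmem, hnormv]; exact hu
    · exact hmemr _ (hsqmem u hu)
    · rw [hnormv, Complex.norm_real, Real.norm_eq_abs, abs_of_nonneg (Real.sqrt_nonneg _)]
  have hsq0 : Real.sqrt (r ^ 2 + (0 : ℝ) ^ 2) = r := by simp [Real.sqrt_sq hr0.le]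
  have hk2 : HasDerivAt (fun s : ℝ => fderiv ℝ φ ((Real.sqrt (r ^ 2 + s ^ 2) : ℝ) : ℂ) 1 *
        (s / Real.sqrt (r ^ 2 + s ^ 2))) (fderiv ℝ φ (r : ℂ) 1 / r) 0 := by
    have h1 : HasDerivAt (fun s : ℝ => fderiv ℝ φ ((Real.sqrt (r ^ 2 + s ^ 2) : ℝ) : ℂ) 1)
        (fderiv ℝ (fun w => fderiv ℝ φ w 1) ((Real.sqrt (r ^ 2 + (0:ℝ) ^ 2) : ℝ) : ℂ) 1 *
          ((0:ℝ) / Real.sqrt (r ^ 2 + (0:ℝ) ^ 2))) 0 :=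
      (hf1 _ (by rw [hsq0]; exact hr')).comp (0:ℝ) (hsq 0)
    have h2 := (hasDerivAt_id (0:ℝ)).div (hsq 0) (by rw [hsq0]; exact hr0.ne')
    have h3 := h1.mul h2
    refine HasDerivAt.congr_deriv (f := fun s : ℝ =>
      fderiv ℝ φ ((Real.sqrt (r ^ 2 + s ^ 2) : ℝ) : ℂ) 1 *
        (s / Real.sqrt (r ^ 2 + s ^ 2))) h3 ?_
    rw [hsq0]
    simp only [id, zero_div, mul_zero, zero_mul, zero_add, one_mul, sub_zero]
    field_simp
  have hval := hk1.unique (hk2.congr_of_eventuallyEq hkeq)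
  have := (hasDerivAt_id r).mul (hf1 r hr')
  refine HasDerivAt.congr_deriv (f := fun s : ℝ => s * fderiv ℝ φ (s : ℂ) 1) this ?_
  rw [laplacian, hval]
  simp only [id, one_mul]
  field_simp
  ring

lemma log_div_deriv {x a : ℝ} (hx : 0 < x) (ha : 0 < a) :
    HasDerivAt (fun x => Real.log (x / a)) (1 / x) x := by
  refine HasDerivAt.congr_deriv (f := fun x : ℝ => Real.log (x / a))
    (((hasDerivAt_id x).div_const a).log (div_ne_zero hx.ne' ha.ne')) ?_
  simp only [id]
  field_simp

/-- Monotonicity from a derivative computed by `HasDerivAt` on `[a,1)`. -/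
lemma mono_aux {F F' : ℝ → ℝ} {a : ℝ} (h : ∀ r ∈ Set.Ico a 1, HasDerivAt F (F' r) r)
    (hn : ∀ r ∈ Set.Ico a 1, 0 ≤ F' r) {r : ℝ} (hr : r ∈ Set.Ico a 1) : F a ≤ F r := by
  have hm : MonotoneOn F (Set.Ico a 1) := by
    apply monotoneOn_of_deriv_nonneg (convex_Ico a 1)
    · exact fun x hx => (h x hx).continuousAt.continuousWithinAt
    · exact fun x hx => (h x (interior_subset hx)).differentiableAt.differentiableWithinAt
    · intro x hx
      rw [(h x (interior_subset hx)).deriv]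
      exact hn x (interior_subset hx)
  exact hm ⟨le_rfl, lt_of_le_of_lt hr.1 hr.2⟩ hr hr.1

lemma outer_est {f g g' τ τ' : ℝ → ℝ} {a c ε N K M : ℝ}
    (ha : 1 / 2 ≤ a) (hc : 0 < c) (hε : 0 < ε) (hM : 0 ≤ M)
    (hf : ∀ r ∈ Set.Ico a 1, HasDerivAt f (g r / r) r)
    (hg : ∀ r ∈ Set.Ico a 1, HasDerivAt g (g' r) r)
    (hg' : ∀ r ∈ Set.Ico a 1, c / τ r ^ 2 ≤ g' r)
    (hτ : ∀ r ∈ Set.Ico a 1, HasDerivAt τ (τ' r) r)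
    (hτ' : ∀ r ∈ Set.Ico a 1, |τ' r| ≤ ε)
    (hpos : ∀ r ∈ Set.Ico a 1, 0 < τ r)
    (hanti : ∀ r ∈ Set.Ico a 1, τ r ≤ τ a)
    (hτ1 : τ a ≤ 1) (hN : N ≤ g a + 2) (hK : K ≤ 1 / τ a)
    (hMε : M * ε ≤ c / (2 * ε)) {r : ℝ} (hr : r ∈ Set.Ico a 1) :
    -((2 * (c / (2 * ε) + 2 + M)) ^ 2 / c) ≤
      f r - f a - N * Real.log (r / a) - M * Real.log (τ a / τ r)
        - M * K * Real.log (r / a) := by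
  have haI : a ∈ Set.Ico a 1 := ⟨le_rfl, lt_of_le_of_lt hr.1 hr.2⟩
  have hτa := hpos a haI
  have ha0 : 0 < a := by linarith
  -- first lower bound for the increment of `g`
  have i1 : ∀ s ∈ Set.Ico a 1, c / ε * (1 / τ s - 1 / τ a) ≤ g s - g a := by
    intro s hs
    have := mono_aux (F := fun x => g x - c / ε * (τ x)⁻¹)
      (F' := fun x => g' x - c / ε * (-τ' x / τ x ^ 2)) (a := a)
      (fun x hx => (hg x hx).sub (((hτ x hx).inv (hpos x hx).ne').const_mul _)) ?_ hs
    · simp only [one_div]; linarith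
    · intro x hx
      have h1 := hg' x hx
      have h2 := (abs_le.1 (hτ' x hx)).1
      have h3 := hpos x hx
      have : c / ε * (-τ' x / τ x ^ 2) ≤ c / τ x ^ 2 := by
        calc c / ε * (-τ' x / τ x ^ 2) ≤ c / ε * (ε / τ x ^ 2) := by gcongr; linarith
          _ = c / τ x ^ 2 := by field_simp
      linarith
  have i2 : ∀ s ∈ Set.Ico a 1, c / τ a ^ 2 * (s - a) ≤ g s - g a := by
    intro s hs
    have := mono_aux (F := fun x => g x - c / τ a ^ 2 * x)
      (F' := fun x => g' x - c / τ a ^ 2 * 1) (a := a)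
      (fun x hx => (hg x hx).sub ((hasDerivAt_id x).const_mul _)) ?_ hs
    · linarith
    · intro x hx
      have h1 := hg' x hx
      have h3 := hpos x hx
      have : c / τ a ^ 2 ≤ c / τ x ^ 2 := by gcongr; exact hanti x hx
      linarith
  set B := 2 * (c / (2 * ε) + 2 + M) with hB
  have hBpos : 0 < B := by positivity
  have hlog : ∀ x ∈ Set.Ico a 1, HasDerivAt (fun x => Real.log (x / a)) (1 / x) x := by
    intro x hx
    have hx0 : 0 < x := by linarith [hx.1]
    exact log_div_deriv hx0 ha0
  have hlogτ : ∀ x ∈ Set.Ico a 1,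
      HasDerivAt (fun x => Real.log (τ a / τ x)) (-τ' x / τ x) x := by
    intro x hx
    have hx0 := hpos x hx
    have := ((hasDerivAt_const x (τ a)).div (hτ x hx) hx0.ne').log (by
      simp only [Pi.div_apply]; positivity)
    refine HasDerivAt.congr_deriv (f := fun x => Real.log (τ a / τ x)) this ?_
    simp only [Pi.div_apply]
    field_simp
    ring
  have key := mono_aux (a := a)
    (F := fun x => f x - f a - N * Real.log (x / a) - M * Real.log (τ a / τ x)
        - M * K * Real.log (x / a) - c / (4 * τ a ^ 2) * (x - a) ^ 2 + B / τ a * (x - a))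
    (F' := fun x => g x / x - N * (1 / x) - M * (-τ' x / τ x) - M * K * (1 / x)
        - c / (4 * τ a ^ 2) * (2 * (x - a)) + B / τ a * 1) ?_ ?_ hr
  · simp only [sub_self, div_self ha0.ne', div_self hτa.ne', Real.log_one] at key
    have hq : -(B ^ 2 / c) ≤ c / (4 * τ a ^ 2) * (r - a) ^ 2 - B / τ a * (r - a) := by
      have : c / (4 * τ a ^ 2) * (r - a) ^ 2 - B / τ a * (r - a) + B ^ 2 / c
        = (c * (r - a) / τ a - 2 * B) ^ 2 / (4 * c) := by field_simp; ring
      have h2 : 0 ≤ (c * (r - a) / τ a - 2 * B) ^ 2 / (4 * c) := by positivity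
      linarith
    linarith
  · intro x hx
    have hsq : HasDerivAt (fun x : ℝ => (x - a) ^ 2) (2 * (x - a)) x := by
      refine HasDerivAt.congr_deriv (f := fun x : ℝ => (x - a) ^ 2)
        (((hasDerivAt_id x).sub_const a).pow 2) ?_
      simp
    exact ((((((hf x hx).sub_const (f a)).sub ((hlog x hx).const_mul N)).sub
      ((hlogτ x hx).const_mul M)).sub ((hlog x hx).const_mul (M * K))).sub
      (hsq.const_mul _)).add (((hasDerivAt_id x).sub_const a).const_mul _)
  · intro x hx
    have hx0 : 0 < x := by linarith [hx.1]
    have hτx := hpos x hx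
    have j1 := i1 x hx
    have j2 := i2 x hx
    have hxa : 0 ≤ x - a := by linarith [hx.1]
    -- bound for the `τ'` term
    have k1 : M * (-τ' x / τ x) * x ≤ c / (2 * ε) * (1 / τ x) := by
      have h2 : -τ' x ≤ ε := by linarith [(abs_le.1 (hτ' x hx)).1]
      calc M * (-τ' x / τ x) * x ≤ M * (ε / τ x) * x := by gcongr
        _ ≤ M * (ε / τ x) * 1 := by gcongr; exact hx.2.le
        _ = M * ε * (1 / τ x) := by ring
        _ ≤ _ := by gcongr
    have k2 : N + M * K ≤ g a + (2 + M) * (1 / τ a) := by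
      have : M * K ≤ M * (1 / τ a) := by gcongr
      have h1 : 1 ≤ 1 / τ a := by rw [le_div_iff₀ hτa]; linarith
      linarith
    have hX : 0 ≤ c / (2 * τ a ^ 2) * (x - a) := by positivity
    have hj2 : c / τ a ^ 2 * (x - a) = 2 * (c / (2 * τ a ^ 2) * (x - a)) := by
      field_simp
    have hj1 : c / ε * (1 / τ x - 1 / τ a) =
        2 * (c / (2 * ε) * (1 / τ x)) - 2 * (c / (2 * ε) * (1 / τ a)) := by
      field_simp
    have hBe : B / τ a = 2 * (c / (2 * ε) * (1 / τ a) + (2 + M) * (1 / τ a)) := by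
      rw [hB]; field_simp; ring
    have hY : 0 ≤ c / (2 * ε) * (1 / τ a) + (2 + M) * (1 / τ a) := by positivity
    have hS : c / (4 * τ a ^ 2) * (2 * (x - a)) = c / (2 * τ a ^ 2) * (x - a) := by
      field_simp; ring
    set X := c / (2 * τ a ^ 2) * (x - a)
    set Y := c / (2 * ε) * (1 / τ a) + (2 + M) * (1 / τ a)
    have main : X - Y ≤ g x - N - M * (-τ' x / τ x) * x - M * K := by
      linarith
    have e : g x / x - N * (1 / x) - M * (-τ' x / τ x) - M * K * (1 / x)
        = (g x - N - M * (-τ' x / τ x) * x - M * K) / x := by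
      field_simp
    rw [e, hS, hBe]
    have : X - 2 * Y ≤ (g x - N - M * (-τ' x / τ x) * x - M * K) / x := by
      rw [le_div_iff₀ hx0]
      have h1 : X * x ≤ X := mul_le_of_le_one_right hX hx.2.le
      have h2 : Y ≤ 2 * Y * x := by nlinarith [hx.1]
      nlinarith
    linarith

lemma exp_form {x a : ℝ} (hx : 0 < x) (ha : 0 < a) (N : ℕ) :
    (x / a) ^ N = Real.exp (N * Real.log (x / a)) := by
  rw [mul_comm, ← Real.rpow_def_of_pos (by positivity), Real.rpow_natCast]

/-- Two-sided estimate on the interval `|r-a| < τ a`. -/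
lemma inner_est {f g g' : ℝ → ℝ} {a c N t : ℝ} {I : Set ℝ} (hI : Convex ℝ I)
    (haI : a ∈ I) (ht : 0 < t) (ht1 : t ≤ 1) (hc : 0 < c)
    (hl : ∀ r ∈ I, 1 / 4 ≤ r) (hd : ∀ r ∈ I, |r - a| ≤ t)
    (hf : ∀ r ∈ I, HasDerivAt f (g r / r) r)
    (hg : ∀ r ∈ I, HasDerivAt g (g' r) r)
    (hg' : ∀ r ∈ I, |g' r| ≤ c / t ^ 2)
    (hN1 : g a ≤ N) (hN2 : N ≤ g a + 2) {r : ℝ} (hr : r ∈ I) :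
    f r - f a - N * Real.log (r / a) ≤ 4 * (c + 2) := by
  have ha0 : 0 < a := by linarith [hl a haI]
  have h1 : ∀ x ∈ I, |g x - N| ≤ (c + 2) / t := by
    intro x hx
    have := hI.norm_image_sub_le_of_norm_hasDerivWithin_le (f := g) (f' := g')
      (C := c / t ^ 2) (fun y hy => (hg y hy).hasDerivWithinAt) hg' haI hx
    rw [Real.norm_eq_abs, Real.norm_eq_abs] at this
    have h2 : c / t ^ 2 * |x - a| ≤ c / t ^ 2 * t := by gcongr; exact hd x hx
    have h3 : c / t ^ 2 * t = c / t := by field_simp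
    have h4 : |g x - N| ≤ |g x - g a| + |g a - N| := abs_sub_le _ _ _
    have h5 : |g a - N| ≤ 2 := by rw [abs_le]; constructor <;> linarith
    have h6 : (2 : ℝ) ≤ 2 / t := by rw [le_div_iff₀ ht]; linarith
    rw [add_div]; linarith
  have := hI.norm_image_sub_le_of_norm_hasDerivWithin_le
    (f := fun x => f x - N * Real.log (x / a)) (f' := fun x => g x / x - N * (1 / x))
    (C := 4 * ((c + 2) / t)) (x := a) (y := r) ?_ ?_ haI hr
  · rw [Real.norm_eq_abs, Real.norm_eq_abs] at this
    have h2 : 4 * ((c + 2) / t) * |r - a| ≤ 4 * ((c + 2) / t) * t := by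
      gcongr; exact hd r hr
    have h3 : 4 * ((c + 2) / t) * t = 4 * (c + 2) := by field_simp
    simp only [div_self ha0.ne', Real.log_one] at this
    have := le_abs_self (f r - N * Real.log (r / a) - (f a - N * 0))
    linarith
  · intro x hx
    have hx0 : 0 < x := by linarith [hl x hx]
    have hlog : HasDerivAt (fun x => Real.log (x / a)) (1 / x) x := by
      exact log_div_deriv hx0 ha0
    exact ((hf x hx).sub (hlog.const_mul N)).hasDerivWithinAt
  · intro x hx
    have hx0 : 0 < x := by linarith [hl x hx]
    have e : g x / x - N * (1 / x) = (g x - N) / x := by field_simp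
    rw [e, Real.norm_eq_abs, abs_div, abs_of_pos hx0, div_le_iff₀ hx0]
    have := h1 x hx
    have h2 : 0 ≤ (c + 2) / t := by positivity
    nlinarith [hl x hx]

/-- For `r ≤ a` the function decreases towards `0`. -/
lemma below_est {f g : ℝ → ℝ} {a N : ℝ}
    (hf : ∀ r ∈ Set.Ioc 0 a, HasDerivAt f (g r / r) r)
    (hg : ∀ r ∈ Set.Ioc 0 a, g r ≤ N) {r : ℝ} (hr : r ∈ Set.Ioc 0 a) :
    0 ≤ f r - f a - N * Real.log (r / a) := by
  have ha0 : 0 < a := lt_of_lt_of_le hr.1 hr.2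
  have hD : ∀ x ∈ Set.Ioc 0 a, HasDerivAt (fun x => f x - N * Real.log (x / a))
      (g x / x - N * (1 / x)) x := by
    intro x hx
    have hx0 : 0 < x := hx.1
    have hlog : HasDerivAt (fun x => Real.log (x / a)) (1 / x) x := by
      exact log_div_deriv hx0 ha0
    exact (hf x hx).sub (hlog.const_mul N)
  have hm : AntitoneOn (fun x => f x - N * Real.log (x / a)) (Set.Ioc 0 a) := by
    apply antitoneOn_of_deriv_nonpos (convex_Ioc 0 a)
    · exact fun x hx => (hD x hx).continuousAt.continuousWithinAt
    · exact fun x hx => (hD x (interior_subset hx)).differentiableAt.differentiableWithinAt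
    · intro x hx
      have hx := interior_subset hx
      rw [(hD x hx).deriv]
      have e : g x / x - N * (1 / x) = (g x - N) / x := by ring
      rw [e]
      exact div_nonpos_of_nonpos_of_nonneg (by linarith [hg x hx]) hx.1.le
  have := hm hr ⟨ha0, le_rfl⟩ hr.2
  simp only [div_self ha0.ne', Real.log_one] at this
  linarith

/-- The averaged geometric kernel. -/
def avgK (K : ℕ) (w : ℂ) : ℂ := (K : ℂ)⁻¹ * ∑ k ∈ Finset.range K, w ^ k

lemma avgK_le (K : ℕ) (hK : 1 ≤ K) (w : ℂ) : ‖avgK K w‖ ≤ (max 1 ‖w‖) ^ K := by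
  have hK0 : (0 : ℝ) < K := by exact_mod_cast hK
  rw [avgK, norm_mul, norm_inv, Complex.norm_natCast, inv_mul_le_iff₀ hK0]
  calc ‖∑ k ∈ Finset.range K, w ^ k‖ ≤ ∑ k ∈ Finset.range K, ‖w ^ k‖ := norm_sum_le _ _
    _ ≤ ∑ k ∈ Finset.range K, (max 1 ‖w‖) ^ K := by
        apply Finset.sum_le_sum
        intro k hk
        rw [norm_pow]
        calc ‖w‖ ^ k ≤ (max 1 ‖w‖) ^ k := by gcongr; exact le_max_right _ _
          _ ≤ _ := pow_le_pow_right₀ (le_max_left _ _) (Finset.mem_range.1 hk).le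
    _ = K * (max 1 ‖w‖) ^ K := by simp

lemma avgK_le' (K : ℕ) (hK : 1 ≤ K) (w : ℂ) (hw : w ≠ 1) :
    ‖avgK K w‖ ≤ (max 1 ‖w‖) ^ K * (2 / (K * ‖w - 1‖)) := by
  have hK0 : (0 : ℝ) < K := by exact_mod_cast hK
  have hw0 : 0 < ‖w - 1‖ := norm_pos_iff.2 (sub_ne_zero.2 hw)
  rw [avgK, geom_sum_eq hw, norm_mul, norm_inv, Complex.norm_natCast, norm_div]
  have h1 : ‖w ^ K - 1‖ ≤ 2 * (max 1 ‖w‖) ^ K := by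
    calc ‖w ^ K - 1‖ ≤ ‖w ^ K‖ + ‖(1 : ℂ)‖ := norm_sub_le _ _
      _ ≤ (max 1 ‖w‖) ^ K + (max 1 ‖w‖) ^ K := by
        rw [norm_pow, norm_one]
        gcongr
        · exact le_max_right _ _
        · exact one_le_pow₀ (le_max_left _ _)
      _ = _ := by ring
  calc (K : ℝ)⁻¹ * (‖w ^ K - 1‖ / ‖w - 1‖) ≤ (K : ℝ)⁻¹ * (2 * (max 1 ‖w‖) ^ K / ‖w - 1‖) := by
        gcongr
    _ = _ := by field_simp

lemma avgK_ge (K : ℕ) (hK : 1 ≤ K) (w : ℂ) (hw : K * ‖w - 1‖ ≤ 1 / 2) :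
    1 / 4 ≤ ‖avgK K w‖ := by
  have hK0 : (0 : ℝ) < K := by exact_mod_cast hK
  have hpow : ∀ k ∈ Finset.range K, ‖w ^ k - 1‖ ≤ 3 / 4 := by
    intro k hk
    have hkK : (k : ℝ) ≤ K := by exact_mod_cast (Finset.mem_range.1 hk).le
    have hge : ‖w ^ k - 1‖ ≤ (1 + ‖w - 1‖) ^ k - 1 := by
      clear hk hkK
      induction k with
      | zero => simp
      | succ k ih =>
        have e : w ^ (k + 1) - 1 = (w ^ k - 1) * w + (w - 1) := by ring
        have hw1 : ‖w‖ ≤ 1 + ‖w - 1‖ := by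
          calc ‖w‖ = ‖1 + (w - 1)‖ := by ring_nf
            _ ≤ _ := by simpa using norm_add_le (1 : ℂ) (w - 1)
        calc ‖w ^ (k + 1) - 1‖ ≤ ‖w ^ k - 1‖ * ‖w‖ + ‖w - 1‖ := by
              rw [e]; exact (norm_add_le _ _).trans (by rw [norm_mul])
          _ ≤ ((1 + ‖w - 1‖) ^ k - 1) * (1 + ‖w - 1‖) + ‖w - 1‖ := by
              gcongr
              exact (norm_nonneg _).trans ih
          _ = _ := by ring
    have h2 : (1 + ‖w - 1‖) ^ k ≤ Real.exp (1 / 2) := by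
      calc (1 + ‖w - 1‖) ^ k ≤ (Real.exp ‖w - 1‖) ^ k := by
            gcongr; linarith [Real.add_one_le_exp ‖w - 1‖]
        _ = Real.exp (k * ‖w - 1‖) := by rw [← Real.exp_nat_mul]
        _ ≤ _ := by
            apply Real.exp_le_exp.2
            refine le_trans ?_ hw
            gcongr
    have h3 : Real.exp (1 / 2) ≤ 7 / 4 := by
      have h4 : Real.exp (1 / 2) ^ 2 = Real.exp 1 := by
        rw [← Real.exp_nat_mul]; norm_num
      have h5 := Real.exp_one_lt_d9
      nlinarith [Real.exp_pos (1 / 2 : ℝ)]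
    linarith
  have e : avgK K w = 1 + (K : ℂ)⁻¹ * ∑ k ∈ Finset.range K, (w ^ k - 1) := by
    have : (K : ℂ) ≠ 0 := by exact_mod_cast hK0.ne'
    rw [avgK, Finset.sum_sub_distrib]
    simp
    field_simp
    ring
  have h1 : ‖(K : ℂ)⁻¹ * ∑ k ∈ Finset.range K, (w ^ k - 1)‖ ≤ 3 / 4 := by
    rw [norm_mul, norm_inv, Complex.norm_natCast, inv_mul_le_iff₀ hK0]
    calc _ ≤ ∑ k ∈ Finset.range K, ‖w ^ k - 1‖ := norm_sum_le _ _
      _ ≤ ∑ k ∈ Finset.range K, (3 / 4 : ℝ) := Finset.sum_le_sum hpow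
      _ = _ := by simp
  have h2 : ‖(1 : ℂ)‖ - ‖-((K : ℂ)⁻¹ * ∑ k ∈ Finset.range K, (w ^ k - 1))‖ ≤ ‖avgK K w‖ := by
    rw [e]
    simpa using norm_sub_norm_le (1 : ℂ) (-((K : ℂ)⁻¹ * ∑ k ∈ Finset.range K, (w ^ k - 1)))
  rw [norm_neg, norm_one] at h2
  linarith

lemma int_bound : ∃ C : ℝ, 0 < C ∧ ∀ (α : ℂ) (t : ℝ), 0 < t →
    ∫⁻ z, ENNReal.ofReal ((1 + ‖z - α‖ / t) ^ (-3 : ℝ)) ∂dA ≤ ENNReal.ofReal (C * t ^ 2) := by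
  have hfin := finite_integral_one_add_norm (E := ℂ) (μ := volume) (r := 3)
    (by rw [Complex.finrank_real_complex]; norm_num)
  set J := ∫⁻ x : ℂ, ENNReal.ofReal ((1 + ‖x‖) ^ (-3 : ℝ)) ∂volume with hJ
  have hpi : (ENNReal.ofReal Real.pi)⁻¹ ≠ ⊤ := by
    simp [Real.pi_pos]
  set c : ENNReal := (ENNReal.ofReal Real.pi)⁻¹ * J
  have hc : c ≠ ⊤ := ENNReal.mul_ne_top hpi hfin.ne
  refine ⟨c.toReal + 1, by positivity, fun α t ht => ?_⟩
  have hmeas : Measurable fun x : ℂ => ENNReal.ofReal ((1 + ‖x‖) ^ (-3 : ℝ)) := by fun_prop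
  have h1 : ∫⁻ z, ENNReal.ofReal ((1 + ‖z - α‖ / t) ^ (-3 : ℝ)) = ENNReal.ofReal (t ^ 2) * J := by
    calc ∫⁻ z, ENNReal.ofReal ((1 + ‖z - α‖ / t) ^ (-3 : ℝ))
        = ∫⁻ z : ℂ, ENNReal.ofReal ((1 + ‖z‖ / t) ^ (-3 : ℝ)) :=
          lintegral_sub_right_eq_self (fun z : ℂ => ENNReal.ofReal ((1 + ‖z‖ / t) ^ (-3 : ℝ))) α
      _ = ∫⁻ z : ℂ, ENNReal.ofReal ((1 + ‖t⁻¹ • z‖) ^ (-3 : ℝ)) := by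
          congr 1
          ext z
          rw [norm_smul, Real.norm_eq_abs, abs_of_pos (inv_pos.2 ht), div_eq_inv_mul]
      _ = ∫⁻ x : ℂ, ENNReal.ofReal ((1 + ‖x‖) ^ (-3 : ℝ))
            ∂(Measure.map (t⁻¹ • ·) (volume : Measure ℂ)) := by
          rw [lintegral_map hmeas (measurable_const_smul _)]
      _ = _ := by
          rw [Measure.map_addHaar_smul _ (inv_pos.2 ht).ne', lintegral_smul_measure,
            Complex.finrank_real_complex, smul_eq_mul]
          congr 2
          rw [inv_pow, inv_inv, abs_of_pos (by positivity)]
  rw [dA, lintegral_smul_measure, h1, smul_eq_mul, mul_left_comm, mul_comm]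
  rw [ENNReal.ofReal_mul (by positivity)]
  gcongr
  refine (ENNReal.le_ofReal_iff_toReal_le hc (by positivity)).2 (by linarith)

lemma dA_ball (α : ℂ) (t : ℝ) (ht : 0 < t) :
    dA (Metric.ball α t) = ENNReal.ofReal (t ^ 2) := by
  rw [dA, Measure.smul_apply, Complex.volume_ball, smul_eq_mul, mul_left_comm]
  have : ENNReal.ofReal Real.pi = (NNReal.pi : ENNReal) := by
    rw [ENNReal.ofReal]; congr 1
    ext; simp [Real.pi_pos.le]
  rw [this, ENNReal.inv_mul_cancel, mul_one, ENNReal.ofReal_pow ht.le]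
  · simp [NNReal.pi_ne_zero]
  · simp

lemma lap_bounds {L t C : ℝ} (hL : 0 < L) (ht : 0 < t) (hC : 1 ≤ C)
    (h1 : t / C ≤ L ^ (-(1 / 2 : ℝ))) (h2 : L ^ (-(1 / 2 : ℝ)) ≤ C * t) :
    1 / C ^ 2 / t ^ 2 ≤ L ∧ L ≤ C ^ 2 / t ^ 2 := by
  have hs : L ^ (-(1 / 2 : ℝ)) = (Real.sqrt L)⁻¹ := by
    rw [Real.rpow_neg hL.le, ← Real.sqrt_eq_rpow]
  have hsp : 0 < Real.sqrt L := Real.sqrt_pos.2 hL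
  have hsq : Real.sqrt L ^ 2 = L := Real.sq_sqrt hL.le
  have hC0 : 0 < C := by linarith
  rw [hs] at h1 h2
  constructor
  · have h3 : 1 ≤ C * t * Real.sqrt L := by
      rwa [← div_le_iff₀ hsp, one_div]
    rw [← hsq, div_div, div_le_iff₀ (by positivity)]
    calc (1 : ℝ) ≤ (C * t * Real.sqrt L) ^ 2 := one_le_pow₀ h3
      _ = _ := by ring
  · have h3 : t * Real.sqrt L ≤ C := by
      rw [div_le_iff₀ hC0] at h1
      calc t * Real.sqrt L ≤ (Real.sqrt L)⁻¹ * C * Real.sqrt L := by gcongr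
        _ = C := by field_simp
    rw [← hsq, le_div_iff₀ (by positivity)]
    calc Real.sqrt L ^ 2 * t ^ 2 = (t * Real.sqrt L) ^ 2 := by ring
      _ ≤ C ^ 2 := by gcongr

/-- The radial profile estimates, with all constants uniform in `a`. -/
lemma profile (ω φ : ℂ → ℝ) (τ : ℝ → ℝ) (hW : IsClassW ω φ τ) (M : ℕ) (hM : 1 ≤ M) :
    ∃ ρ₀ ∈ Set.Ioo (0 : ℝ) 1, ∃ C₁ : ℝ, 1 ≤ C₁ ∧ ∃ c₂ : ℝ, 0 < c₂ ∧
      ∀ a ∈ Set.Ico ρ₀ 1, 1 / 2 ≤ a ∧ τ a ≤ 1 / 16 ∧ τ a ≤ 1 - a ∧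
        ∃ N : ℕ, 1 ≤ N ∧
          (∀ K : ℕ, (K : ℝ) ≤ 1 / τ a → ∀ r ∈ Set.Ico (0 : ℝ) 1,
            Real.exp (φ (a : ℂ) - φ (r : ℂ)) * (r / a) ^ N * (max 1 (r / a)) ^ (K * M)
              ≤ C₁ * (min (τ a) (τ r) / τ a) ^ M) ∧
          (∀ r, |r - a| < τ a → c₂ ≤ Real.exp (φ (a : ℂ) - φ (r : ℂ)) * (r / a) ^ N) := by
  obtain ⟨f1, hf1, hf1c, hg1⟩ := radial_core φ hW.radial hW.smooth
  obtain ⟨C0, hC0, hcomp⟩ := hW.comp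
  set f : ℝ → ℝ := fun s => φ (s : ℂ) with hfdef
  set g : ℝ → ℝ := fun s => s * f1 s with hgdef
  set g' : ℝ → ℝ := fun r => r * laplacian φ (r : ℂ) with hg'def
  have hmemr : ∀ r : ℝ, r ∈ Set.Ico (0 : ℝ) 1 → (r : ℂ) ∈ unitDisc := by
    intro r hr
    rw [unitDisc, mem_ball_zero_iff, Complex.norm_real, Real.norm_eq_abs, abs_of_nonneg hr.1]
    exact hr.2
  have hlap : ∀ r ∈ Set.Ico (0 : ℝ) 1, 1 / C0 ^ 2 / τ r ^ 2 ≤ laplacian φ (r : ℂ) ∧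
      laplacian φ (r : ℂ) ≤ C0 ^ 2 / τ r ^ 2 := by
    intro r hr
    have := hcomp r (hmemr r hr)
    rw [Complex.norm_real, Real.norm_eq_abs, abs_of_nonneg hr.1] at this
    exact lap_bounds (hW.lap_pos _ (hmemr r hr)) (hW.tau_pos r hr) hC0 this.1 this.2
  have hlpos : ∀ r ∈ Set.Ico (0 : ℝ) 1, 0 < laplacian φ (r : ℂ) := fun r hr =>
    hW.lap_pos _ (hmemr r hr)
  have hf : ∀ r ∈ Set.Ioo (0 : ℝ) 1, HasDerivAt f (g r / r) r := by
    intro r hr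
    have : g r / r = f1 r := by
      have := hr.1.ne'
      simp only [hgdef]; field_simp
    rw [this]
    exact hf1 r ⟨by linarith [hr.1], hr.2⟩
  have hgmono : MonotoneOn g (Set.Ico 0 1) := by
    apply monotoneOn_of_deriv_nonneg (convex_Ico 0 1)
    · intro x hx
      exact (continuousAt_id.mul (hf1c x ⟨by linarith [hx.1], hx.2⟩)).continuousWithinAt
    · intro x hx
      rw [interior_Ico] at hx
      exact (hg1 x hx).differentiableAt.differentiableWithinAt
    · intro x hx
      rw [interior_Ico] at hx
      rw [(hg1 x hx).deriv]
      exact mul_nonneg hx.1.le (hlpos x ⟨hx.1.le, hx.2⟩).le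
  have hg0 : g 0 = 0 := by simp [hgdef]
  have hM0 : (0 : ℝ) < M := by exact_mod_cast hM
  -- constants
  set c : ℝ := 1 / C0 ^ 2 / 2 with hc
  have hcpos : 0 < c := by positivity
  set ε : ℝ := min (1 / 8) (c / (2 * M)) with hε
  have hεpos : 0 < ε := by positivity
  have hε8 : ε ≤ 1 / 8 := min_le_left _ _
  have hMε : M * ε ≤ c / (2 * ε) := by
    have h1 : ε ≤ c / (2 * M) := min_le_right _ _
    rw [le_div_iff₀ (by positivity)] at h1 ⊢
    nlinarith
  obtain ⟨ρ₁, hρ₁, hder⟩ : ∃ ρ₁ < (1 : ℝ), ∀ r ∈ Set.Ioo ρ₁ 1, |deriv τ r| ≤ ε := by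
    have h := hW.tau_deriv_lim (Metric.closedBall_mem_nhds 0 hεpos)
    obtain ⟨l, hl, hl'⟩ := mem_nhdsLT_iff_exists_Ioo_subset.1 (Filter.mem_map.1 h)
    refine ⟨l, hl, fun r hr => ?_⟩
    simpa using hl' hr
  refine ⟨max (1 / 2) ((ρ₁ + 1) / 2), ⟨by positivity, by
    rw [max_lt_iff]; constructor <;> linarith⟩,
    Real.exp ((2 * (c / (2 * ε) + 2 + M)) ^ 2 / c), Real.one_le_exp (by positivity),
    Real.exp (-(4 * (4 * C0 ^ 2 + 2))), Real.exp_pos _, ?_⟩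
  rintro a ⟨ha, ha1⟩
  have ha2 : 1 / 2 ≤ a := le_trans (le_max_left _ _) ha
  have ha3 : ρ₁ < a := lt_of_lt_of_le (by linarith) (le_trans (le_max_right _ _) ha)
  have ha0 : 0 < a := by linarith
  have haI : a ∈ Set.Ico (0 : ℝ) 1 := ⟨ha0.le, ha1⟩
  have hsub : ∀ r ∈ Set.Ico a 1, r ∈ Set.Ico (0 : ℝ) 1 := fun r hr =>
    ⟨by linarith [hr.1], hr.2⟩
  have hτd : ∀ r ∈ Set.Ico a 1, HasDerivAt τ (deriv τ r) r := fun r hr =>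
    (hW.tau_diff r (hsub r hr)).hasDerivAt
  have hτ' : ∀ r ∈ Set.Ico a 1, |deriv τ r| ≤ ε := fun r hr =>
    hder r ⟨by linarith [hr.1], hr.2⟩
  have hτlip : ∀ r ∈ Set.Ico a 1, τ a - ε * (r - a) ≤ τ r := by
    intro r hr
    have := mono_aux (F := fun x => τ x + ε * x) (F' := fun x => deriv τ x + ε * 1) (a := a)
      (fun x hx => (hτd x hx).add ((hasDerivAt_id x).const_mul ε))
      (fun x hx => by linarith [(abs_le.1 (hτ' x hx)).1]) hr
    linarith
  have hτa : 0 < τ a := hW.tau_pos a haI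
  have hτε : τ a ≤ ε * (1 - a) := by
    refine ge_of_tendsto (x := nhdsWithin 1 (Set.Iio 1))
      (f := fun r => τ r + ε * (1 - a)) (by simpa using hW.tau_lim.add_const (ε * (1 - a))) ?_
    filter_upwards [Ioo_mem_nhdsLT ha1] with r hr
    have := hτlip r ⟨hr.1.le, hr.2⟩
    nlinarith [hr.2]
  have hτ16 : τ a ≤ 1 / 16 := by nlinarith
  have hτle : τ a ≤ 1 - a := by nlinarith
  have hga : 0 ≤ g a := by
    rw [← hg0]; exact hgmono ⟨le_rfl, one_pos⟩ haI ha0.le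
  refine ⟨ha2, hτ16, hτle, ⌈g a⌉₊ + 1, by omega, ?_, ?_⟩
  · intro K hK r hr
    have hN2 : ((⌈g a⌉₊ + 1 : ℕ) : ℝ) ≤ g a + 2 := by
      push_cast; linarith [Nat.ceil_lt_add_one hga]
    have hN1 : g a ≤ ((⌈g a⌉₊ + 1 : ℕ) : ℝ) := by
      push_cast; linarith [Nat.le_ceil (g a)]
    have hNpos : ⌈g a⌉₊ + 1 ≠ 0 := by omega
    generalize ⌈g a⌉₊ + 1 = N at hN1 hN2 hNpos ⊢
    have hτr := hW.tau_pos r hr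
    rcases le_total a r with har | har
    · have hrI : r ∈ Set.Ico a 1 := ⟨har, hr.2⟩
      have hr0 : 0 < r := by linarith
      have hanti : ∀ s ∈ Set.Ico a 1, τ s ≤ τ a := fun s hs =>
        hW.tau_anti haI (hsub s hs) hs.1
      have key := outer_est (f := f) (g := g) (g' := g') (τ := τ) (τ' := deriv τ)
        (a := a) (c := c) (ε := ε) (N := N) (K := K) (M := M) ha2 hcpos hεpos hM0.le
        (fun s hs => hf s ⟨by linarith [hs.1], hs.2⟩)
        (fun s hs => hg1 s ⟨by linarith [hs.1], hs.2⟩)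
        (fun s hs => by
          have h1 := (hlap s (hsub s hs)).1
          have h2 := hlpos s (hsub s hs)
          have h3 : c / τ s ^ 2 = 1 / 2 * (1 / C0 ^ 2 / τ s ^ 2) := by rw [hc]; ring
          rw [h3]
          simp only [hg'def]
          nlinarith [hs.1])
        hτd hτ' (fun s hs => hW.tau_pos s (hsub s hs)) hanti (by linarith) hN2 hK hMε hrI
      rw [min_eq_right (hanti r hrI), max_eq_right (by rw [le_div_iff₀ ha0]; linarith),
        exp_form hr0 ha0 N, exp_form hr0 ha0 (K * M), exp_form hτr hτa M,
        ← Real.exp_add, ← Real.exp_add, ← Real.exp_add]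
      apply Real.exp_le_exp.2
      have hl : Real.log (τ r / τ a) = - Real.log (τ a / τ r) := by
        rw [← Real.log_inv, inv_div]
      rw [hl]
      push_cast
      simp only [hfdef] at key
      linarith
    · rw [min_eq_left (hW.tau_anti hr haI har), div_self hτa.ne', one_pow, mul_one,
        max_eq_left (by rw [div_le_iff₀ ha0]; linarith), one_pow, mul_one]
      refine le_trans ?_ (Real.one_le_exp (by positivity))
      rcases eq_or_lt_of_le hr.1 with h0 | h0
      · rw [← h0, zero_div, zero_pow hNpos, mul_zero]; exact zero_le_one
      · have key := below_est (f := f) (g := g) (a := a) (N := N)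
          (fun s hs => hf s ⟨hs.1, by linarith [hs.2]⟩)
          (fun s hs => le_trans (hgmono ⟨hs.1.le, by linarith [hs.2]⟩ haI hs.2) hN1)
          ⟨h0, har⟩
        rw [exp_form h0 ha0 N, ← Real.exp_add]
        apply Real.exp_le_one_iff.2
        simp only [hfdef] at key
        linarith
  · intro r hr
    have hN2 : ((⌈g a⌉₊ + 1 : ℕ) : ℝ) ≤ g a + 2 := by
      push_cast; linarith [Nat.ceil_lt_add_one hga]
    have hN1 : g a ≤ ((⌈g a⌉₊ + 1 : ℕ) : ℝ) := by
      push_cast; linarith [Nat.le_ceil (g a)]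
    generalize ⌈g a⌉₊ + 1 = N at hN1 hN2 ⊢
    have hIsub : ∀ s ∈ Set.Ioo (a - τ a) (a + τ a), s ∈ Set.Ioo (0 : ℝ) 1 ∧ 1 / 4 ≤ s := by
      intro s hs
      have h1 := hs.1
      have h2 := hs.2
      refine ⟨⟨by linarith, by nlinarith⟩, by linarith⟩
    have hrI : r ∈ Set.Ioo (a - τ a) (a + τ a) := by
      rw [abs_lt] at hr
      exact ⟨by linarith [hr.1], by linarith [hr.2]⟩
    have hr0 := (hIsub r hrI).1.1
    have key := inner_est (f := f) (g := g) (g' := g') (a := a) (c := 4 * C0 ^ 2) (N := N)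
      (t := τ a) (convex_Ioo (a - τ a) (a + τ a)) ⟨by linarith, by linarith⟩ hτa (by linarith)
      (by positivity) (fun s hs => (hIsub s hs).2)
      (fun s hs => by rw [abs_le]; constructor <;> linarith [hs.1, hs.2])
      (fun s hs => hf s (hIsub s hs).1) (fun s hs => hg1 s (hIsub s hs).1)
      (fun s hs => by
        have hs1 := (hIsub s hs).1
        have hs2 : s ∈ Set.Ico (0 : ℝ) 1 := ⟨hs1.1.le, hs1.2⟩
        have hl := hlpos s hs2
        have hτs : τ a / 2 ≤ τ s := by
          rcases le_total a s with h | h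
          · have := hτlip s ⟨h, hs1.2⟩
            nlinarith [hs.2]
          · linarith [hW.tau_anti hs2 haI h]
        have h1 := (hlap s hs2).2
        have h2 : C0 ^ 2 / τ s ^ 2 ≤ C0 ^ 2 / (τ a / 2) ^ 2 := by gcongr
        have h3 : C0 ^ 2 / (τ a / 2) ^ 2 = 4 * C0 ^ 2 / τ a ^ 2 := by field_simp; ring
        simp only [hg'def]
        rw [abs_of_nonneg (mul_nonneg hs1.1.le hl.le)]
        nlinarith [hs1.2]) hN1 hN2 hrI
    rw [exp_form hr0 ha0 N, ← Real.exp_add]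
    apply Real.exp_le_exp.2
    simp only [hfdef] at key
    linarith

lemma decay_cmp {x t d C : ℝ} {m : ℕ} (hm : 3 ≤ 2 * m) (ht : 0 < t) (hd : 0 ≤ d) (hx : 0 ≤ x)
    (hC : 0 ≤ C) (h1 : x ≤ C) (h2 : d ≠ 0 → x ≤ C * (t / d) ^ m) :
    x ^ 2 ≤ 8 * C ^ 2 * (1 + d / t) ^ (-3 : ℝ) := by
  have hy : 0 < 1 + d / t := by positivity
  have e : (1 + d / t) ^ (-3 : ℝ) = 1 / (1 + d / t) ^ 3 := by
    rw [Real.rpow_neg hy.le, one_div]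
    norm_cast
  rw [e]
  rcases le_total d t with h | h
  · have h3 : d / t ≤ 1 := by rw [div_le_iff₀ ht]; linarith
    have h4 : (1 + d / t) ^ 3 ≤ 2 ^ 3 := by gcongr; linarith
    have h5 : x ^ 2 ≤ C ^ 2 := by gcongr
    rw [mul_one_div, le_div_iff₀ (by positivity)]
    calc x ^ 2 * (1 + d / t) ^ 3 ≤ C ^ 2 * 2 ^ 3 := by gcongr
      _ = _ := by ring
  · have hd0 : 0 < d := lt_of_lt_of_le ht h
    have h3 := h2 hd0.ne'
    have h4 : t / d ≤ 1 := by rw [div_le_iff₀ hd0]; linarith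
    have h5 : 1 + d / t ≤ 2 * (d / t) := by
      have : 1 ≤ d / t := by rw [le_div_iff₀ ht]; linarith
      linarith
    rw [mul_one_div, le_div_iff₀ (by positivity)]
    calc x ^ 2 * (1 + d / t) ^ 3 ≤ (C * (t / d) ^ m) ^ 2 * (2 * (d / t)) ^ 3 := by gcongr
      _ = C ^ 2 * (t / d) ^ (2 * m) * (8 * (d / t) ^ 3) := by ring
      _ ≤ C ^ 2 * (t / d) ^ 3 * (8 * (d / t) ^ 3) := by
          gcongr C ^ 2 * ?_ * _
          exact pow_le_pow_of_le_one (by positivity) h4 hm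
      _ = _ := by field_simp


theorem stmt11 (ω φ : ℂ → ℝ) (τ : ℝ → ℝ) (hW : IsClassW ω φ τ) (n : ℕ) (hn : 1 ≤ n) :
    ∃ ρ₀ ∈ Set.Ioo (0 : ℝ) 1, ∃ C : ℝ, 1 ≤ C ∧
      ∀ α ∈ unitDisc, ρ₀ ≤ ‖α‖ →
        ∃ F : ℂ → ℂ, DifferentiableOn ℂ F unitDisc ∧
          (∃ M : ℝ, ∀ w ∈ unitDisc, ‖F w‖ ≤ M) ∧
          (∀ w ∈ unitDisc, ‖w - α‖ < radialize τ α →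
            C⁻¹ ≤ ‖F w‖ ^ 2 * ω w ∧ ‖F w‖ ^ 2 * ω w ≤ C) ∧
          TestDecay (radialize τ) ω C n α F ∧
          ENNReal.ofReal ((radialize τ α / C) ^ 2) ≤
            (∫⁻ w in unitDisc, ENNReal.ofReal (‖F w‖ ^ 2 * ω w) ∂dA) ∧
          (∫⁻ w in unitDisc, ENNReal.ofReal (‖F w‖ ^ 2 * ω w) ∂dA) ≤
            ENNReal.ofReal ((C * radialize τ α) ^ 2) := by
  obtain ⟨ρ₀, hρ₀, C₁, hC₁, c₂, hc₂, hprof⟩ := profile ω φ τ hW (3 * n) (by omega)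
  obtain ⟨CI, hCI, hIntBd⟩ := int_bound
  set C₃ : ℝ := C₁ * 16 ^ (3 * n) with hC₃
  have hC₃1 : 1 ≤ C₃ := one_le_mul_of_one_le_of_one_le hC₁ (one_le_pow₀ (by norm_num))
  have hC₁3 : C₁ ≤ C₃ := le_mul_of_one_le_right (by linarith) (one_le_pow₀ (by norm_num))
  set c₄ : ℝ := (c₂ * (1 / 4) ^ (3 * n)) ^ 2 with hc₄
  have hc₄pos : 0 < c₄ := by positivity
  set C : ℝ := 1 + c₄⁻¹ + C₃ ^ 2 + C₃ + 8 * C₃ ^ 2 * CI with hC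
  have p1 : 0 < c₄⁻¹ := by positivity
  have p2 : 0 < C₃ ^ 2 := by positivity
  have p3 : 0 < 8 * C₃ ^ 2 * CI := by positivity
  have hC1 : 1 ≤ C := by linarith
  have hC0 : 0 < C := by linarith
  have hCc : C⁻¹ ≤ c₄ := by
    rw [inv_le_comm₀ hC0 hc₄pos]; linarith
  refine ⟨ρ₀, hρ₀, C, hC1, ?_⟩
  intro α hα hαρ
  have hmem : ∀ z : ℂ, z ∈ unitDisc ↔ ‖z‖ < 1 := fun z => by simp [unitDisc]
  set a : ℝ := ‖α‖ with ha
  have ha1 : a < 1 := (hmem α).1 hα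
  obtain ⟨ha2, hτ16, hτle, N, hN, hup, hlow⟩ := hprof a ⟨hαρ, ha1⟩
  have ha0 : 0 < a := by linarith
  have haI : a ∈ Set.Ico (0 : ℝ) 1 := ⟨ha0.le, ha1⟩
  have hα0 : α ≠ 0 := norm_pos_iff.1 ha0
  have ht : 0 < τ a := hW.tau_pos a haI
  set t : ℝ := τ a with htdef
  -- the size of the kernel
  obtain ⟨K, hK1, hKl, hKu⟩ : ∃ K : ℕ, 1 ≤ K ∧ 1 / (8 * t) ≤ (K : ℝ) ∧ (K : ℝ) ≤ 1 / (4 * t) := by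
    refine ⟨⌈1 / (8 * t)⌉₊, Nat.one_le_ceil_iff.2 (by positivity), Nat.le_ceil _, ?_⟩
    have h1 := Nat.ceil_lt_add_one (a := 1 / (8 * t)) (by positivity)
    have h2 : 1 ≤ 1 / (8 * t) := by rw [le_div_iff₀ (by positivity)]; linarith
    have h3 : 1 / (4 * t) = 2 * (1 / (8 * t)) := by field_simp; norm_num
    linarith
  have hKpos : (0 : ℝ) < K := by exact_mod_cast hK1
  have hup := hup K (by
    refine hKu.trans ?_
    gcongr
    linarith)
  have hφr : ∀ z ∈ unitDisc, φ ((‖z‖ : ℝ) : ℂ) = φ z := by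
    intro z hz
    apply hW.radial _ _ _ hz
    · rw [Complex.norm_real, norm_norm]
    · rw [hmem, Complex.norm_real, norm_norm]; exact (hmem z).1 hz
  have hsqrt : ∀ z ∈ unitDisc, Real.sqrt (ω z) = Real.exp (-φ ((‖z‖ : ℝ) : ℂ)) := by
    intro z hz
    rw [hW.omega_eq z hz, hφr z hz]
    have : Real.exp (-(2 * φ z)) = Real.exp (-φ z) ^ 2 := by
      rw [← Real.exp_nat_mul]; congr 1; push_cast; ring
    rw [this, Real.sqrt_sq (Real.exp_pos _).le]
  set F : ℂ → ℂ := fun z =>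
    (Real.exp (φ (a : ℂ)) : ℂ) * (z / α) ^ N * (avgK K (z / α)) ^ (3 * n) with hF
  have hFdiff : Differentiable ℂ F := by
    have h1 : Differentiable ℂ fun z : ℂ => z / α := differentiable_id.div_const α
    have h2 : Differentiable ℂ fun z : ℂ => avgK K (z / α) := by
      unfold avgK
      exact (Differentiable.fun_sum fun k _ => h1.pow k).const_mul _
    exact ((h1.pow N).const_mul _).mul (h2.pow (3 * n))
  have hFnorm : ∀ z ∈ unitDisc, ‖F z‖ * Real.sqrt (ω z) =
      Real.exp (φ (a : ℂ) - φ ((‖z‖ : ℝ) : ℂ)) * (‖z‖ / a) ^ N *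
        ‖avgK K (z / α)‖ ^ (3 * n) := by
    intro z hz
    rw [hsqrt z hz, sub_eq_add_neg, Real.exp_add]
    simp only [hF]
    rw [norm_mul, norm_mul, norm_pow, norm_pow, norm_div, Complex.norm_real, Real.norm_eq_abs,
      abs_of_pos (Real.exp_pos _)]
    ring
  have hsq : ∀ z ∈ unitDisc, ‖F z‖ ^ 2 * ω z = (‖F z‖ * Real.sqrt (ω z)) ^ 2 := by
    intro z hz
    rw [mul_pow, Real.sq_sqrt (hW.pos z hz).le]
  -- general upper bound
  have hgen : ∀ z ∈ unitDisc, ∀ q : ℝ, 0 ≤ q →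
      ‖avgK K (z / α)‖ ≤ (max 1 (‖z‖ / a)) ^ K * q →
      ‖F z‖ * Real.sqrt (ω z) ≤ C₁ * (min t (τ ‖z‖) / t * q) ^ (3 * n) := by
    intro z hz q hq hle
    rw [hFnorm z hz]
    have hz1 : ‖z‖ ∈ Set.Ico (0 : ℝ) 1 := ⟨norm_nonneg z, (hmem z).1 hz⟩
    calc _ ≤ Real.exp (φ (a : ℂ) - φ ((‖z‖ : ℝ) : ℂ)) * (‖z‖ / a) ^ N *
          ((max 1 (‖z‖ / a)) ^ K * q) ^ (3 * n) := by gcongr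
      _ = (Real.exp (φ (a : ℂ) - φ ((‖z‖ : ℝ) : ℂ)) * (‖z‖ / a) ^ N *
          (max 1 (‖z‖ / a)) ^ (K * (3 * n))) * q ^ (3 * n) := by
          rw [mul_pow, ← pow_mul]; ring
      _ ≤ (C₁ * (min t (τ ‖z‖) / t) ^ (3 * n)) * q ^ (3 * n) :=
          mul_le_mul_of_nonneg_right (hup ‖z‖ hz1) (by positivity)
      _ = _ := by rw [mul_pow]; ring
  have hτz : ∀ z ∈ unitDisc, 0 < τ ‖z‖ := fun z hz =>
    hW.tau_pos _ ⟨norm_nonneg z, (hmem z).1 hz⟩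
  have hw1 : ∀ z : ℂ, ‖z / α - 1‖ = ‖z - α‖ / a := by
    intro z
    rw [div_sub_one hα0, norm_div]
  have hB1 : ∀ z ∈ unitDisc, ‖F z‖ * Real.sqrt (ω z) ≤ C₃ := by
    intro z hz
    have hz2 := hτz z hz
    refine (hgen z hz 1 zero_le_one ?_).trans ?_
    · have := avgK_le K hK1 (z / α)
      rwa [norm_div, ← mul_one (_ ^ K)] at this
    · refine le_trans ?_ hC₁3
      apply mul_le_of_le_one_right (by linarith)
      apply pow_le_one₀ (by positivity)
      rw [mul_one, div_le_iff₀ ht, one_mul]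
      exact min_le_left _ _
  have hB2 : ∀ z ∈ unitDisc, z ≠ α → ‖F z‖ * Real.sqrt (ω z) ≤
      C₃ * (min t (τ ‖z‖) / ‖z - α‖) ^ (3 * n) := by
    intro z hz hzα
    have hz2 := hτz z hz
    have hd : 0 < ‖z - α‖ := norm_pos_iff.2 (sub_ne_zero.2 hzα)
    refine (hgen z hz (16 * t / ‖z - α‖) (by positivity) ?_).trans (le_of_eq ?_)
    · have := avgK_le' K hK1 (z / α) (by
        intro h
        rw [div_eq_one_iff_eq hα0] at h
        exact hzα h)
      rw [norm_div] at this
      refine this.trans ?_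
      refine mul_le_mul_of_nonneg_left ?_ (by positivity)
      rw [hw1, div_le_div_iff₀ (by positivity) hd]
      have h1 : 1 ≤ K * (8 * t) := by
        rwa [div_le_iff₀ (by positivity)] at hKl
      have h2 : ‖z - α‖ ≤ ‖z - α‖ / a := by
        rw [le_div_iff₀ ha0]
        exact mul_le_of_le_one_right hd.le ha1.le
      calc 2 * ‖z - α‖ ≤ 2 * ((K * (8 * t)) * (‖z - α‖ / a)) := by
            gcongr
            calc ‖z - α‖ ≤ ‖z - α‖ / a := h2
              _ = 1 * (‖z - α‖ / a) := (one_mul _).symm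
              _ ≤ _ := by gcongr
        _ = _ := by ring
    · have : min t (τ ‖z‖) / t * (16 * t / ‖z - α‖) = 16 * (min t (τ ‖z‖) / ‖z - α‖) := by
        field_simp
      rw [this, mul_pow, hC₃]; ring
  have hL : ∀ z ∈ unitDisc, ‖z - α‖ < t → c₄ ≤ ‖F z‖ ^ 2 * ω z := by
    intro z hz hzα
    rw [hsq z hz, hFnorm z hz, hc₄]
    have h1 : c₂ ≤ Real.exp (φ (a : ℂ) - φ ((‖z‖ : ℝ) : ℂ)) * (‖z‖ / a) ^ N :=
      hlow ‖z‖ (lt_of_le_of_lt (abs_norm_sub_norm_le z α) hzα)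
    have h2 : 1 / 4 ≤ ‖avgK K (z / α)‖ := by
      apply avgK_ge K hK1
      rw [hw1]
      calc (K : ℝ) * (‖z - α‖ / a) ≤ 1 / (4 * t) * (t / (1 / 2)) := by gcongr
        _ = 1 / 2 := by field_simp; norm_num
    gcongr
  refine ⟨F, hFdiff.differentiableOn, ?_, ?_, ⟨?_, ?_⟩, ?_, ?_⟩
  · obtain ⟨B, hB⟩ := (isCompact_closedBall (0 : ℂ) 1).exists_bound_of_continuousOn
      hFdiff.continuous.continuousOn
    exact ⟨B, fun w hw => hB w (Metric.ball_subset_closedBall hw)⟩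
  · intro w hw hwα
    refine ⟨hCc.trans (hL w hw hwα), ?_⟩
    rw [hsq w hw]
    calc (‖F w‖ * Real.sqrt (ω w)) ^ 2 ≤ C₃ ^ 2 := by
          gcongr
          exact hB1 w hw
      _ ≤ C := by linarith
  · intro z hz
    exact (hB1 z hz).trans (by linarith)
  · intro z hz hzα
    refine (hB2 z hz hzα).trans ?_
    have hz2 := hτz z hz
    change C₃ * (min t (τ ‖z‖) / ‖z - α‖) ^ (3 * n) ≤ C * (min t (τ ‖z‖) / ‖z - α‖) ^ (3 * n)
    gcongr
    linarith
  · change ENNReal.ofReal ((t / C) ^ 2) ≤ _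
    have hsub : Metric.ball α t ⊆ unitDisc := by
      intro z hz
      rw [mem_ball_iff_norm] at hz
      rw [hmem]
      have := norm_sub_norm_le z α
      linarith
    calc ENNReal.ofReal ((t / C) ^ 2) ≤ ENNReal.ofReal (c₄ * t ^ 2) := by
          apply ENNReal.ofReal_le_ofReal
          have h1 : C⁻¹ ^ 2 ≤ C⁻¹ := by
            have : C⁻¹ ≤ 1 := inv_le_one_of_one_le₀ hC1
            have h0 : 0 < C⁻¹ := by positivity
            nlinarith
          calc (t / C) ^ 2 = C⁻¹ ^ 2 * t ^ 2 := by rw [div_eq_mul_inv]; ring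
            _ ≤ c₄ * t ^ 2 := by gcongr; exact h1.trans hCc
      _ = ∫⁻ w in Metric.ball α t, ENNReal.ofReal c₄ ∂dA := by
          rw [setLIntegral_const, dA_ball α t ht, ENNReal.ofReal_mul hc₄pos.le]
      _ ≤ ∫⁻ w in Metric.ball α t, ENNReal.ofReal (‖F w‖ ^ 2 * ω w) ∂dA := by
          apply setLIntegral_mono' Metric.isOpen_ball.measurableSet
          intro w hw
          exact ENNReal.ofReal_le_ofReal (hL w (hsub hw) (mem_ball_iff_norm.1 hw))
      _ ≤ _ := lintegral_mono_set hsub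
  · change _ ≤ ENNReal.ofReal ((C * t) ^ 2)
    calc ∫⁻ w in unitDisc, ENNReal.ofReal (‖F w‖ ^ 2 * ω w) ∂dA
        ≤ ∫⁻ w in unitDisc, ENNReal.ofReal (8 * C₃ ^ 2) *
            ENNReal.ofReal ((1 + ‖w - α‖ / t) ^ (-3 : ℝ)) ∂dA := by
          apply setLIntegral_mono' Metric.isOpen_ball.measurableSet
          intro w hw
          have hw2 := hτz w hw
          rw [← ENNReal.ofReal_mul (by positivity)]
          apply ENNReal.ofReal_le_ofReal
          rw [hsq w hw]
          refine decay_cmp (m := 3 * n) (by omega) ht (norm_nonneg _) (by positivity)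
            (by linarith) (hB1 w hw) ?_
          intro hd
          have hwα : w ≠ α := fun h => hd (by rw [h, sub_self, norm_zero])
          refine (hB2 w hw hwα).trans ?_
          gcongr
          exact min_le_left _ _
      _ ≤ ∫⁻ w, ENNReal.ofReal (8 * C₃ ^ 2) *
            ENNReal.ofReal ((1 + ‖w - α‖ / t) ^ (-3 : ℝ)) ∂dA :=
          setLIntegral_le_lintegral _ _
      _ = ENNReal.ofReal (8 * C₃ ^ 2) *
            ∫⁻ w, ENNReal.ofReal ((1 + ‖w - α‖ / t) ^ (-3 : ℝ)) ∂dA :=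
          lintegral_const_mul' _ _ ENNReal.ofReal_ne_top
      _ ≤ ENNReal.ofReal (8 * C₃ ^ 2) * ENNReal.ofReal (CI * t ^ 2) := by
          gcongr
          exact hIntBd α t ht
      _ = ENNReal.ofReal (8 * C₃ ^ 2 * CI * t ^ 2) := by
          rw [← ENNReal.ofReal_mul (by positivity)]; congr 1; ring
      _ ≤ _ := by
          apply ENNReal.ofReal_le_ofReal
          have h1 : 8 * C₃ ^ 2 * CI ≤ C ^ 2 := by nlinarith
          calc 8 * C₃ ^ 2 * CI * t ^ 2 ≤ C ^ 2 * t ^ 2 := by gcongr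
            _ = _ := by ring
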